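/- arXiv:0903.0198 — 5 statements merged into one kernel-verified Lean document; each statement's English description precedes it below -/
import Mathlib

section
/- There is an absolute constant C > 1 such that for every positive integer t, every 3-partite finite simple graph with parts of equal size m ≥ C^t in which each of the three pairwise edge densities between parts is at least 7/8, contains a copy of K_{t,t,t} with t vertices in each part. -/
open SimpleGraph Finset

/-- The number of graph homomorphisms from `H` to `G`. -/
noncomputable def homCount {α β : Type*} (H : SimpleGraph α) (G : SimpleGraph β) : ℕ :=
  Nat.card (H →g G)

/-- The `H`-density of `G`: the number of homomorphisms from `H` to `G`
divided by `|V(G)|^|V(H)|`. -/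
noncomputable def homDensity {α β : Type*} [Fintype α] [Fintype β]
    (H : SimpleGraph α) (G : SimpleGraph β) : ℝ :=
  (homCount H G : ℝ) / (Fintype.card β : ℝ) ^ (Fintype.card α)

/-- The triangle `K₃`. -/
def triangleGraph : SimpleGraph (Fin 3) := ⊤

/-- The complete tripartite graph `K_{a,b,c}`, the `(a,b,c)`-blowup of the triangle. -/
def Kabc (a b c : ℕ) : SimpleGraph (Σ i : Fin 3, Fin (![a, b, c] i)) :=
  completeMultipartiteGraph (fun i => Fin (![a, b, c] i))
lemma aux_popular {α : Type*} (S : Finset α) (f : α → ℕ) (M c : ℕ)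
    (h : ∀ x ∈ S, f x ≤ M) :
    ∑ x ∈ S, f x ≤ M * (S.filter (fun x => c ≤ f x)).card + c * S.card := by
  classical
  have h1 : ∀ x ∈ S, f x ≤ (if c ≤ f x then M else 0) + c := by
    intro x hx
    have := h x hx
    split_ifs <;> omega
  refine (Finset.sum_le_sum h1).trans ?_
  rw [Finset.sum_add_distrib, ← Finset.sum_filter]
  simp [mul_comm]

lemma aux_double {α β : Type*} (A : Finset α) (B : Finset β) (R : α → β → Prop)
    [∀ a b, Decidable (R a b)] :
    ∑ a ∈ A, (B.filter (fun b => R a b)).card = ∑ b ∈ B, (A.filter (fun a => R a b)).card := by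
  simp only [Finset.card_filter]
  exact Finset.sum_comm

lemma aux_prod {α β : Type*} (A : Finset α) (B : Finset β) (R : α → β → Prop)
    [∀ a b, Decidable (R a b)] :
    ((A ×ˢ B).filter (fun p => R p.1 p.2)).card = ∑ a ∈ A, (B.filter (fun b => R a b)).card := by
  simp only [Finset.card_filter]
  exact Finset.sum_product _ _ _

lemma aux_KST {α : Type*} (A B : Finset α) (R : α → α → Prop)
    [∀ a b, Decidable (R a b)] (t : ℕ) (ht : 0 < t)
    (hd : A.card * B.card ≤ 8 * ((A ×ˢ B).filter (fun p => R p.1 p.2)).card)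
    (hA : 512 * t ≤ A.card) (hB : 32 * t * 2 ^ (32 * t) ≤ B.card) :
    ∃ S T : Finset α, S ⊆ A ∧ T ⊆ B ∧ S.card = t ∧ T.card = t ∧ ∀ x ∈ S, ∀ y ∈ T, R x y := by
  classical
  have hBpos : 0 < B.card := lt_of_lt_of_le (by positivity) hB
  have h1 := aux_popular A (fun a => 16 * (B.filter (fun b => R a b)).card) (16 * B.card) B.card
    (fun x _ => Nat.mul_le_mul_left _ (Finset.card_filter_le _ _))
  rw [← Finset.mul_sum, ← aux_prod] at h1
  set A1 := A.filter (fun a => B.card ≤ 16 * (B.filter (fun b => R a b)).card) with hA1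
  have h2 : A.card ≤ 16 * A1.card := by
    have : B.card * A.card ≤ B.card * (16 * A1.card) := by nlinarith
    exact Nat.le_of_mul_le_mul_left this hBpos
  obtain ⟨A0, hA0, hA0c⟩ := Finset.exists_subset_card_eq (s := A1) (n := 32 * t) (by omega)
  have h3 : 2 * t * B.card ≤ ∑ a ∈ A0, (B.filter (fun b => R a b)).card := by
    have : A0.card * B.card ≤ ∑ a ∈ A0, 16 * (B.filter (fun b => R a b)).card := by
      rw [← smul_eq_mul]
      apply Finset.card_nsmul_le_sum
      intro x hx
      exact (Finset.mem_filter.1 (hA0 hx)).2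
    rw [← Finset.mul_sum, hA0c] at this
    nlinarith
  rw [aux_double] at h3
  have h4 := aux_popular B (fun b => (A0.filter (fun a => R a b)).card) (32 * t) t
    (fun x _ => hA0c ▸ Finset.card_filter_le _ _)
  set B1 := B.filter (fun b => t ≤ (A0.filter (fun a => R a b)).card) with hB1
  have h5 : B.card ≤ 32 * B1.card := by
    have : t * B.card ≤ t * (32 * B1.card) := by nlinarith
    exact Nat.le_of_mul_le_mul_left this ht
  obtain ⟨a, ha, hc⟩ := Finset.exists_le_card_fiber_of_mul_le_card_of_maps_to
    (s := B1) (t := A0.powerset) (f := fun b => A0.filter (fun a => R a b)) (n := t)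
    (fun b _ => by simp) ⟨∅, by simp⟩
    (by rw [Finset.card_powerset, hA0c]; nlinarith)
  obtain ⟨T, hT, hTc⟩ := Finset.exists_subset_card_eq hc
  have hTn : T.Nonempty := by rw [← Finset.card_pos]; omega
  obtain ⟨b0, hb0⟩ := hTn
  have hb := Finset.mem_filter.1 (hT hb0)
  have hat : t ≤ a.card := by
    rw [← hb.2]; exact (Finset.mem_filter.1 hb.1).2
  obtain ⟨S, hS, hSc⟩ := Finset.exists_subset_card_eq hat
  refine ⟨S, T, ?_, ?_, hSc, hTc, ?_⟩
  · intro x hx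
    exact (Finset.mem_filter.1 (hA0 (Finset.mem_powerset.1 ha (hS hx)))).1
  · intro y hy
    exact (Finset.mem_filter.1 (Finset.mem_filter.1 (hT hy)).1).1
  · intro x hx y hy
    have h6 := (Finset.mem_filter.1 (hT hy)).2
    have h7 := hS hx
    rw [← h6] at h7
    exact (Finset.mem_filter.1 h7).2

lemma aux_tri {α : Type*} (X Y Z : Finset α) (R : α → α → Prop)
    [∀ a b, Decidable (R a b)] (m : ℕ) (hX : X.card = m) (hY : Y.card = m) (hZ : Z.card = m)
    (h1 : 7 * (m * m) ≤ 8 * ((X ×ˢ Y).filter (fun p => R p.1 p.2)).card)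
    (h2 : 7 * (m * m) ≤ 8 * ((X ×ˢ Z).filter (fun p => R p.1 p.2)).card)
    (h3 : 7 * (m * m) ≤ 8 * ((Y ×ˢ Z).filter (fun p => R p.1 p.2)).card) :
    5 * (m * m * m) ≤ 8 * ∑ x ∈ X, (((Y ×ˢ Z).filter (fun p => R p.1 p.2)).filter
      (fun p => R x p.1 ∧ R x p.2)).card := by
  classical
  have key : ∀ x ∈ X, m * (Y.filter (fun y => R x y)).card + m * (Z.filter (fun y => R x y)).card
      + ((Y ×ˢ Z).filter (fun p => R p.1 p.2)).card ≤
      (((Y ×ˢ Z).filter (fun p => R p.1 p.2)).filter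
      (fun p => R x p.1 ∧ R x p.2)).card + 2 * (m * m) := by
    intro x _
    have e1 : m * (Y.filter (fun y => R x y)).card
        = ∑ p ∈ Y ×ˢ Z, if R x p.1 then 1 else 0 := by
      rw [Finset.sum_product_right]
      simp [hZ]
    have e2 : m * (Z.filter (fun y => R x y)).card
        = ∑ p ∈ Y ×ˢ Z, if R x p.2 then 1 else 0 := by
      rw [Finset.sum_product]
      simp [hY]
    have e3 : 2 * (m * m) = ∑ p ∈ Y ×ˢ Z, 2 := by
      simp [hY, hZ, mul_comm]
    rw [e1, e2, e3, Finset.filter_filter, Finset.card_filter, Finset.card_filter,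
      ← Finset.sum_add_distrib, ← Finset.sum_add_distrib, ← Finset.sum_add_distrib]
    apply Finset.sum_le_sum
    intro p _
    by_cases a : R x p.1 <;> by_cases b : R x p.2 <;> by_cases c : R p.1 p.2 <;> simp [a, b, c]
  have := Finset.sum_le_sum key
  rw [Finset.sum_add_distrib, Finset.sum_add_distrib, Finset.sum_add_distrib, ← Finset.mul_sum,
    ← Finset.mul_sum, ← aux_prod, ← aux_prod, Finset.sum_const, Finset.sum_const, hX,
    smul_eq_mul, smul_eq_mul] at this
  have g1 := Nat.mul_le_mul_left m h1
  have g2 := Nat.mul_le_mul_left m h2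
  have g3 := Nat.mul_le_mul_left m h3
  nlinarith

set_option maxHeartbeats 1600000 in
lemma aux_main {α : Type*} (X Y Z : Finset α) (R : α → α → Prop)
    [∀ a b, Decidable (R a b)] (m t : ℕ) (ht : 0 < t) (hm : 2 ^ (60 * t) ≤ m)
    (hX : X.card = m) (hY : Y.card = m) (hZ : Z.card = m)
    (h1 : 7 * (m * m) ≤ 8 * ((X ×ˢ Y).filter (fun p => R p.1 p.2)).card)
    (h2 : 7 * (m * m) ≤ 8 * ((X ×ˢ Z).filter (fun p => R p.1 p.2)).card)
    (h3 : 7 * (m * m) ≤ 8 * ((Y ×ˢ Z).filter (fun p => R p.1 p.2)).card) :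
    ∃ S T U : Finset α, S ⊆ X ∧ T ⊆ Y ∧ U ⊆ Z ∧ S.card = t ∧ T.card = t ∧ U.card = t ∧
          (∀ x ∈ S, ∀ y ∈ T, R x y) ∧
          (∀ x ∈ S, ∀ y ∈ U, R x y) ∧
          (∀ x ∈ T, ∀ y ∈ U, R x y) := by
  classical
  have htri := aux_tri X Y Z R m hX hY hZ h1 h2 h3
  have hmpos : 0 < m := lt_of_lt_of_le (by positivity) hm
  have ht2 : t < 2 ^ t := Nat.lt_two_pow_self
  set E := (Y ×ˢ Z).filter (fun p => R p.1 p.2) with hE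
  have hEc : E.card ≤ m * m := by
    refine (Finset.card_filter_le _ _).trans ?_
    rw [Finset.card_product, hY, hZ]
  have q1 := aux_popular X (fun x => 2 * (E.filter (fun p => R x p.1 ∧ R x p.2)).card)
    (2 * (m * m)) (m * m)
    (fun x _ => Nat.mul_le_mul_left _ ((Finset.card_filter_le _ _).trans hEc))
  rw [← Finset.mul_sum, hX] at q1
  set X1 := X.filter
    (fun x => m * m ≤ 2 * (E.filter (fun p => R x p.1 ∧ R x p.2)).card) with hX1
  have q2 : m ≤ 8 * X1.card := by
    have : m * m * m ≤ m * m * (8 * X1.card) := by nlinarith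
    exact Nat.le_of_mul_le_mul_left this (by positivity)
  have q3 : 32 * t ≤ m := by
    refine le_trans ?_ hm
    calc 32 * t ≤ 2 ^ (5 * t) * 2 ^ t := by
          apply Nat.mul_le_mul _ ht2.le
          calc 32 = 2 ^ 5 := by norm_num
            _ ≤ _ := Nat.pow_le_pow_right (by norm_num) (by omega)
      _ = 2 ^ (6 * t) := by rw [← pow_add]; congr 1; ring
      _ ≤ _ := Nat.pow_le_pow_right (by norm_num) (by omega)
  obtain ⟨X0, hX0, hX0c⟩ := Finset.exists_subset_card_eq (s := X1) (n := 4 * t) (by omega)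
  have q4 : 2 * t * (m * m) ≤ ∑ x ∈ X0, (E.filter (fun p => R x p.1 ∧ R x p.2)).card := by
    have : X0.card * (m * m) ≤
        ∑ x ∈ X0, 2 * (E.filter (fun p => R x p.1 ∧ R x p.2)).card := by
      rw [← smul_eq_mul]
      apply Finset.card_nsmul_le_sum
      intro x hx
      exact (Finset.mem_filter.1 (hX0 hx)).2
    rw [← Finset.mul_sum, hX0c] at this
    nlinarith
  rw [aux_double X0 E (fun x p => R x p.1 ∧ R x p.2)] at q4
  have q5 := aux_popular E (fun p => (X0.filter (fun x => R x p.1 ∧ R x p.2)).card) (4 * t) t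
    (fun x _ => hX0c ▸ Finset.card_filter_le _ _)
  set W := E.filter (fun p => t ≤ (X0.filter (fun x => R x p.1 ∧ R x p.2)).card) with hW
  have q6 : m * m ≤ 4 * W.card := by
    have : t * (m * m) ≤ t * (4 * W.card) := by nlinarith
    exact Nat.le_of_mul_le_mul_left this ht
  let τ : α → Finset α := fun y => X0.filter (fun x => R x y)
  have hτ : ∀ y, τ y ∈ X0.powerset := fun y => by simp [τ]
  let N := 2 ^ (4 * t)
  have hN : X0.powerset.card = N := by rw [Finset.card_powerset, hX0c]
  have hWY : ∀ p ∈ W, p.1 ∈ Y ∧ p.2 ∈ Z ∧ R p.1 p.2 ∧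
      t ≤ (X0.filter (fun x => R x p.1 ∧ R x p.2)).card := by
    intro p hp
    have a := Finset.mem_filter.1 hp
    have b := Finset.mem_filter.1 a.1
    have c := Finset.mem_product.1 b.1
    exact ⟨c.1, c.2, b.2, a.2⟩
  have sY : ∑ a ∈ X0.powerset, (Y.filter (fun y => τ y = a)).card = m := by
    rw [← hY]; exact (Finset.card_eq_sum_card_fiberwise (fun y _ => hτ y)).symm
  have sZ : ∑ a ∈ X0.powerset, (Z.filter (fun y => τ y = a)).card = m := by
    rw [← hZ]; exact (Finset.card_eq_sum_card_fiberwise (fun y _ => hτ y)).symm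
  have sW : ∑ q ∈ X0.powerset ×ˢ X0.powerset,
      (W.filter (fun p => (τ p.1, τ p.2) = q)).card = W.card :=
    (Finset.card_eq_sum_card_fiberwise
      (fun p _ => Finset.mem_product.2 ⟨hτ p.1, hτ p.2⟩)).symm
  have hex : ∃ q ∈ X0.powerset ×ˢ X0.powerset,
      (Y.filter (fun y => τ y = q.1)).card * (Z.filter (fun y => τ y = q.2)).card * (N * N) + m * m
      ≤ 8 * (N * N) * (W.filter (fun p => (τ p.1, τ p.2) = q)).card := by
    apply Finset.exists_le_of_sum_le
    · exact ⟨(∅, ∅), by simp⟩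
    rw [Finset.sum_add_distrib, ← Finset.sum_mul, ← Finset.mul_sum (a := 8 * (N * N)), sW, Finset.sum_product]
    simp only
    rw [← Finset.sum_mul_sum, sY, sZ, Finset.sum_const, Finset.card_product, hN, smul_eq_mul]
    nlinarith [Nat.mul_le_mul_left (N * N) q6]
  obtain ⟨⟨a, b⟩, hq, hineq⟩ := hex
  simp only at hineq
  set A := Y.filter (fun y => τ y = a) with hA
  set B := Z.filter (fun y => τ y = b) with hB
  set V := W.filter (fun p => (τ p.1, τ p.2) = (a, b)) with hV
  have hNpos : 0 < N := by positivity
  have hVsub : V ⊆ (A ×ˢ B).filter (fun p => R p.1 p.2) := by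
    intro p hp
    have u := Finset.mem_filter.1 hp
    have v := hWY p u.1
    have w := Prod.mk.inj u.2
    simp only [Finset.mem_filter, Finset.mem_product, hA, hB]
    exact ⟨⟨⟨v.1, w.1⟩, v.2.1, w.2⟩, v.2.2.1⟩
  have hVc := Finset.card_le_card hVsub
  have hV2 : V.card ≤ A.card * B.card := by
    refine hVc.trans ((Finset.card_filter_le _ _).trans ?_)
    rw [Finset.card_product]
  have hVpos : 0 < V.card := by
    rcases Nat.eq_zero_or_pos V.card with h | h
    · rw [h] at hineq
      have : 0 < m * m := by positivity
      omega
    · exact h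
  have hd : A.card * B.card ≤ 8 * ((A ×ˢ B).filter (fun p => R p.1 p.2)).card := by
    have : N * N * (A.card * B.card) ≤ N * N * (8 * V.card) := by nlinarith
    have := Nat.le_of_mul_le_mul_left this (by positivity)
    omega
  have hmm : m * m ≤ 8 * (N * N) * (A.card * B.card) := by
    have := Nat.mul_le_mul_left (8 * (N * N)) hV2
    have h0 : 0 ≤ A.card * B.card * (N * N) := Nat.zero_le _
    omega
  have hAm : A.card ≤ m := hY ▸ Finset.card_filter_le _ _
  have hBm : B.card ≤ m := hZ ▸ Finset.card_filter_le _ _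
  have hA3 : m ≤ 8 * (N * N) * A.card := by
    have : m * m ≤ m * (8 * (N * N) * A.card) := by
      calc m * m ≤ 8 * (N * N) * (A.card * B.card) := hmm
        _ = 8 * (N * N) * A.card * B.card := by ring
        _ ≤ 8 * (N * N) * A.card * m := Nat.mul_le_mul_left _ hBm
        _ = _ := by ring
    exact Nat.le_of_mul_le_mul_left this hmpos
  have hB3 : m ≤ 8 * (N * N) * B.card := by
    have : m * m ≤ m * (8 * (N * N) * B.card) := by
      calc m * m ≤ 8 * (N * N) * (A.card * B.card) := hmm
        _ = 8 * (N * N) * B.card * A.card := by ring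
        _ ≤ 8 * (N * N) * B.card * m := Nat.mul_le_mul_left _ hAm
        _ = _ := by ring
    exact Nat.le_of_mul_le_mul_left this hmpos
  have hsize : ∀ k : ℕ, m ≤ 8 * (N * N) * k → 32 * t * 2 ^ (32 * t) ≤ k := by
    intro k hk
    have e : 8 * (N * N) * (32 * t * 2 ^ (32 * t)) ≤ 8 * (N * N) * k := by
      refine le_trans ?_ (hm.trans hk)
      calc 8 * (N * N) * (32 * t * 2 ^ (32 * t))
          = 2 ^ 8 * (N * N) * 2 ^ (32 * t) * t := by ring
        _ ≤ 2 ^ (8 * t) * (N * N) * 2 ^ (32 * t) * 2 ^ t := by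
          have : 2 ^ 8 ≤ 2 ^ (8 * t) := Nat.pow_le_pow_right (by norm_num) (by omega)
          gcongr
        _ = 2 ^ (49 * t) := by
          simp only [N, ← pow_add]; congr 1; ring
        _ ≤ _ := Nat.pow_le_pow_right (by norm_num) (by omega)
    exact Nat.le_of_mul_le_mul_left e (by positivity)
  have hA4 : 512 * t ≤ A.card := by
    refine le_trans ?_ (hsize _ hA3)
    have : 2 ^ 4 ≤ 2 ^ (32 * t) := Nat.pow_le_pow_right (by norm_num) (by omega)
    nlinarith
  obtain ⟨T, U, hT, hU, hTc, hUc, hTU⟩ := aux_KST A B R t ht hd hA4 (hsize _ hB3)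
  obtain ⟨p, hp⟩ := Finset.card_pos.1 hVpos
  have u := Finset.mem_filter.1 hp
  have v := hWY p u.1
  have w := Prod.mk.inj u.2
  obtain ⟨S, hS, hSc⟩ := Finset.exists_subset_card_eq v.2.2.2
  have hSa : ∀ x ∈ S, x ∈ a ∧ x ∈ b := by
    intro x hx
    have z := Finset.mem_filter.1 (hS hx)
    rw [← w.1, ← w.2]
    exact ⟨Finset.mem_filter.2 ⟨z.1, z.2.1⟩, Finset.mem_filter.2 ⟨z.1, z.2.2⟩⟩
  refine ⟨S, T, U, ?_, fun y hy => (Finset.mem_filter.1 (hT hy)).1,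
    fun y hy => (Finset.mem_filter.1 (hU hy)).1, hSc, hTc, hUc, ?_, ?_, hTU⟩
  · intro x hx
    exact (Finset.mem_filter.1 (hX0 (Finset.mem_filter.1 (hS hx)).1)).1
  · intro x hx y hy
    have z := (hSa x hx).1
    rw [← (Finset.mem_filter.1 (hT hy)).2] at z
    exact (Finset.mem_filter.1 z).2
  · intro x hx y hy
    have z := (hSa x hx).2
    rw [← (Finset.mem_filter.1 (hU hy)).2] at z
    exact (Finset.mem_filter.1 z).2

lemma aux_dens {β : Type*} (G : SimpleGraph β) [DecidableRel G.Adj] (X Y : Finset β) (m : ℕ)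
    (hm : 0 < m) (hX : X.card = m) (hY : Y.card = m)
    (h : (7 / 8 : ℝ) ≤ (G.edgeDensity X Y : ℝ)) :
    7 * (m * m) ≤ 8 * ((X ×ˢ Y).filter (fun p => G.Adj p.1 p.2)).card := by
  have e : G.edgeDensity X Y = (((X ×ˢ Y).filter (fun p => G.Adj p.1 p.2)).card : ℚ) / (m * m) := by
    rw [SimpleGraph.edgeDensity_def, hX, hY]; rfl
  rw [e] at h
  push_cast at h
  have hm' : (0 : ℝ) < m := by exact_mod_cast hm
  rw [le_div_iff₀ (by positivity)] at h
  have : (7 : ℝ) * (m * m) ≤ 8 * ((X ×ˢ Y).filter (fun p => G.Adj p.1 p.2)).card := by linarith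
  exact_mod_cast this

/-- There is an absolute constant `C > 1` such that every 3-partite graph with
parts `X, Y, Z` of equal size `m ≥ C^t`, in which each of the three pairwise edge
densities is at least `7/8`, contains a copy of `K_{t,t,t}` with `t` vertices in
each part. -/
theorem tripartite_Kttt :
    ∃ C : ℝ, 1 < C ∧ ∀ t : ℕ, 0 < t →
      ∀ (β : Type) [Fintype β] (G : SimpleGraph β) [DecidableRel G.Adj]
        (X Y Z : Finset β) (m : ℕ),
        Disjoint X Y → Disjoint X Z → Disjoint Y Z →
        (∀ v : β, v ∈ X ∨ v ∈ Y ∨ v ∈ Z) →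
        (∀ x ∈ X, ∀ y ∈ X, ¬ G.Adj x y) →
        (∀ x ∈ Y, ∀ y ∈ Y, ¬ G.Adj x y) →
        (∀ x ∈ Z, ∀ y ∈ Z, ¬ G.Adj x y) →
        X.card = m → Y.card = m → Z.card = m →
        C ^ t ≤ (m : ℝ) →
        (7 / 8 : ℝ) ≤ (G.edgeDensity X Y : ℝ) →
        (7 / 8 : ℝ) ≤ (G.edgeDensity X Z : ℝ) →
        (7 / 8 : ℝ) ≤ (G.edgeDensity Y Z : ℝ) →
        ∃ S T U : Finset β, S ⊆ X ∧ T ⊆ Y ∧ U ⊆ Z ∧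
          S.card = t ∧ T.card = t ∧ U.card = t ∧
          (∀ x ∈ S, ∀ y ∈ T, G.Adj x y) ∧
          (∀ x ∈ S, ∀ y ∈ U, G.Adj x y) ∧
          (∀ x ∈ T, ∀ y ∈ U, G.Adj x y) := by
  refine ⟨2 ^ 60, by norm_num, ?_⟩
  intro t ht β _ G _ X Y Z m _ _ _ _ _ _ _ hX hY hZ hC d1 d2 d3
  rw [← pow_mul] at hC
  have hm : 2 ^ (60 * t) ≤ m := by exact_mod_cast hC
  have hmpos : 0 < m := lt_of_lt_of_le (by positivity) hm
  exact aux_main X Y Z G.Adj m t ht hm hX hY hZ (aux_dens G X Y m hmpos hX hY d1)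
    (aux_dens G X Z m hmpos hX hZ d2) (aux_dens G Y Z m hmpos hY hZ d3)
end

section
/- (Ruzsa–Szemerédi construction) Let n be a positive integer and let S ⊆ {1,…,n} be a set of integers containing no nontrivial 3-term arithmetic progression (i.e., whenever s₁, s₂, s₃ ∈ S satisfy s₁ + s₂ = 2·s₃ one has s₁ = s₂ = s₃). Then there exists a finite simple graph G on 6n vertices with exactly 3·n·|S| edges such that G has exactly n·|S| triangles, these triangles are pairwise edge-disjoint, and every edge of G lies in exactly one triangle (so the edge set of G is partitioned into n·|S| edge-disjoint triangles and G contains no other triangles). -/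
open SimpleGraph Finset

/-- Triangle indices of the construction. -/
def rsIdx (n : ℕ) (S : Finset ℕ) : Finset (Fin n × Fin (2 * n) × Fin (3 * n)) :=
  Finset.univ.filter fun p =>
    ∃ s ∈ S, (p.2.1 : ℕ) = p.1 + s ∧ (p.2.2 : ℕ) = p.1 + 2 * s

lemma rsIdx_card (n : ℕ) (S : Finset ℕ) (hS : S ⊆ Finset.Icc 1 n) :
    (rsIdx n S).card = n * S.card := by
  have : ((Finset.univ : Finset (Fin n)) ×ˢ S).card = n * S.card := by simp
  rw [← this]
  symm
  have hb : ∀ s ∈ S, s ≤ n := fun s hs => (Finset.mem_Icc.1 (hS hs)).2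
  refine Finset.card_bij (fun p hp => (p.1, ⟨p.1 + p.2, ?_⟩, ⟨p.1 + 2 * p.2, ?_⟩)) ?_ ?_ ?_
  · have := hb _ (Finset.mem_product.1 hp).2
    have := p.1.2
    omega
  · have := hb _ (Finset.mem_product.1 hp).2
    have := p.1.2
    omega
  · intro p hp
    simp only [rsIdx, Finset.mem_filter, Finset.mem_univ, true_and]
    exact ⟨p.2, (Finset.mem_product.1 hp).2, rfl, rfl⟩
  · rintro ⟨x, s⟩ _ ⟨y, r⟩ _ h
    simp only [Prod.mk.injEq, Fin.mk.injEq] at h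
    obtain ⟨rfl, h, -⟩ := h
    simpa using h
  · rintro ⟨a, b, c⟩ h
    simp only [rsIdx, Finset.mem_filter, Finset.mem_univ, true_and] at h
    obtain ⟨s, hs, h1, h2⟩ := h
    refine ⟨(a, s), by simpa using hs, ?_⟩
    simp only [Prod.mk.injEq, true_and]
    exact ⟨Fin.ext h1.symm, Fin.ext h2.symm⟩

theorem ruzsa_szemeredi_construction (n : ℕ) (hn : 0 < n) (S : Finset ℕ)
    (hS : S ⊆ Finset.Icc 1 n)
    (hAP : ∀ s₁ ∈ S, ∀ s₂ ∈ S, ∀ s₃ ∈ S, s₁ + s₂ = 2 * s₃ → s₁ = s₂ ∧ s₂ = s₃) :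
    ∃ G : SimpleGraph (Fin (6 * n)),
      G.edgeSet.ncard = 3 * n * S.card ∧
      (G.cliqueSet 3).ncard = n * S.card ∧
      (∀ T₁ ∈ G.cliqueSet 3, ∀ T₂ ∈ G.cliqueSet 3, T₁ ≠ T₂ → (T₁ ∩ T₂).card ≤ 1) ∧
      (∀ e ∈ G.edgeSet, ∃! T, T ∈ G.cliqueSet 3 ∧ ∀ v ∈ e, v ∈ T) := by
  classical
  have : TripartiteFromTriangles.ExplicitDisjoint (rsIdx n S) := by
    constructor <;> intro a b c d h1 h2 <;>
    · simp only [rsIdx, Finset.mem_filter, Finset.mem_univ, true_and] at h1 h2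
      obtain ⟨s, hs, h3, h4⟩ := h1
      obtain ⟨r, hr, h5, h6⟩ := h2
      apply Fin.ext
      omega
  have : TripartiteFromTriangles.NoAccidental (rsIdx n S) := by
    constructor
    intro a a' b b' c c' h1 h2 h3
    simp only [rsIdx, Finset.mem_filter, Finset.mem_univ, true_and] at h1 h2 h3
    obtain ⟨s, hs, h4, h5⟩ := h1
    obtain ⟨r, hr, h6, h7⟩ := h2
    obtain ⟨q, hq, h8, h9⟩ := h3
    have := hAP s hs q hq r hr (by omega)
    left
    apply Fin.ext
    omega
  have e : (Fin n ⊕ Fin (2 * n) ⊕ Fin (3 * n)) ≃ Fin (6 * n) :=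
    Fintype.equivFinOfCardEq (by simp; ring)
  set G₀ := TripartiteFromTriangles.graph (rsIdx n S) with hG₀
  have hL : (G₀.map e.toEmbedding).LocallyLinear :=
    (TripartiteFromTriangles.locallyLinear (rsIdx n S)).map e.toEmbedding
  have hc : #((G₀.map e.toEmbedding).cliqueFinset 3) = n * S.card := by
    rw [cliqueFinset_map _ _ (by norm_num), Finset.card_map,
      TripartiteFromTriangles.card_triangles, rsIdx_card n S hS]
  set G := G₀.map e.toEmbedding with hG
  have hdisj : ∀ T₁ ∈ G.cliqueSet 3, ∀ T₂ ∈ G.cliqueSet 3, T₁ ≠ T₂ → (T₁ ∩ T₂).card ≤ 1 := by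
    intro T₁ h1 T₂ h2 hne
    have := hL.1 h1 h2 hne
    rw [Finset.card_le_one]
    intro a ha b hb
    exact this (by simpa using ha) (by simpa using hb)
  refine ⟨G, ?_, ?_, hdisj, ?_⟩
  · rw [← coe_edgeFinset, Set.ncard_coe_finset, hL.card_edgeFinset, hc, mul_assoc]
  · rw [← coe_cliqueFinset, Set.ncard_coe_finset, hc]
  · intro z
    induction z using Sym2.ind with
    | _ x y =>
      intro hxy
      obtain ⟨T, hT, hx, hy⟩ := hL.2 ((mem_edgeSet G).1 hxy)
      refine ⟨T, ⟨hT, by simp [hx, hy]⟩, ?_⟩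
      rintro T' ⟨hT', hv⟩
      by_contra hne
      have h1 := Finset.card_le_one.1 (hdisj T' hT' T hT hne) x
        (Finset.mem_inter.2 ⟨hv x (by simp), hx⟩) y
        (Finset.mem_inter.2 ⟨hv y (by simp), hy⟩)
      exact ((mem_edgeSet G).1 hxy).ne h1
end

section
/- (Behrend) There is an absolute constant c > 0 such that for every positive integer n there exists a set S ⊆ {1,…,n} containing no nontrivial 3-term arithmetic progression (no s₁, s₂, s₃ ∈ S with s₁ + s₂ = 2·s₃ except s₁ = s₂ = s₃) with |S| ≥ n·exp(−c·√(log n)); in particular |S| = n^{1−o(1)}. -/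
open Finset

/-- (Behrend) There is an absolute constant `c > 0` such that for every `n ≥ 1`
there is a set `S ⊆ {1,…,n}` with no nontrivial 3-term arithmetic progression and
`|S| ≥ n·exp(−c·√(log n))`. -/
theorem behrend :
    ∃ c : ℝ, 0 < c ∧ ∀ n : ℕ, 0 < n →
      ∃ S : Finset ℕ, S ⊆ Finset.Icc 1 n ∧
        (∀ s₁ ∈ S, ∀ s₂ ∈ S, ∀ s₃ ∈ S, s₁ + s₂ = 2 * s₃ → s₁ = s₂ ∧ s₂ = s₃) ∧
        (n : ℝ) * Real.exp (-c * Real.sqrt (Real.log n)) ≤ (S.card : ℝ) := by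
  refine ⟨4, by norm_num, fun n _ => ?_⟩
  obtain ⟨t, ht, hc, hf⟩ := addRothNumber_spec (Finset.Ico 1 (n + 1))
  rw [addRothNumber_Ico, Nat.add_sub_cancel] at hc
  refine ⟨t, fun x hx => ?_, fun a ha b hb c hcm h => ?_, ?_⟩
  · have := Finset.mem_Ico.1 (ht hx)
    exact Finset.mem_Icc.2 ⟨this.1, by omega⟩
  · have h1 : a = c := hf ha hcm hb (by omega)
    omega
  · rw [hc]
    exact Behrend.roth_lower_bound
end

section
/- (Triangle removal lemma, Ruzsa–Szemerédi) For every ε > 0 there exists δ = f(ε) > 0 such that: if G is a finite simple graph on n vertices with the property that one must remove at least ε·n² edges from G in order to destroy all triangles (i.e., every set of fewer than ε·n² edges fails to meet some triangle of G), then G contains at least δ·n³ triangles. -/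
open SimpleGraph

/-- (Triangle removal lemma, Ruzsa–Szemerédi) For every `ε > 0` there is `δ > 0`
such that if removing fewer than `ε·n²` edges from an `n`-vertex graph `G` can
never destroy all triangles, then `G` contains at least `δ·n³` triangles. -/
theorem triangle_removal_lemma (ε : ℝ) (hε : 0 < ε) :
    ∃ δ : ℝ, 0 < δ ∧
      ∀ (β : Type) [Fintype β] (G : SimpleGraph β),
        (∀ F : Set (Sym2 β), (F.ncard : ℝ) < ε * (Fintype.card β : ℝ) ^ 2 →
          ¬ (G.deleteEdges F).CliqueFree 3) →
        δ * (Fintype.card β : ℝ) ^ 3 ≤ ((G.cliqueSet 3).ncard : ℝ) := by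
  classical
  refine ⟨triangleRemovalBound ε, triangleRemovalBound_pos hε, ?_⟩
  intro β _ G h
  have hG : G.FarFromTriangleFree ε := by
    intro s _ hp
    by_contra hlt
    refine h (s : Set (Sym2 β)) ?_ hp
    rw [Set.ncard_coe_finset]
    push_cast at hlt
    exact lt_of_not_ge hlt
  have := hG.le_card_cliqueFinset
  rwa [← Set.ncard_coe_finset, coe_cliqueFinset] at this
end

section
/- There is an absolute constant c > 0 such that for every 0 < γ < 1 and every positive integer t there exists N with the property: every finite simple graph G on n ≥ N vertices with triangle density d_{K_3}(G) ≥ γ has K_{t,t,t}-density d_{K_{t,t,t}}(G) ≥ 2^{−c·t²/γ³}. -/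
open SimpleGraph Finset

open scoped Classical in
/-- Jensen for powers. -/
theorem aux_jensen {ι : Type*} [Fintype ι] (f : ι → ℝ) (hf : ∀ i, 0 ≤ f i) (a : ℝ) (ha : 0 ≤ a)
    (h : a * Fintype.card ι ≤ ∑ i, f i) (m : ℕ) :
    a ^ m * Fintype.card ι ≤ ∑ i, f i ^ m := by
  rcases m with _ | m
  · simp
  rcases Nat.eq_zero_or_pos (Fintype.card ι) with h0 | h0
  · rw [h0]; simp only [Nat.cast_zero, mul_zero]
    exact Finset.sum_nonneg fun i _ => pow_nonneg (hf i) _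
  have hN : (0 : ℝ) < Fintype.card ι := by exact_mod_cast h0
  have h2 := pow_sum_div_card_le_sum_pow (s := (univ : Finset ι)) (f := f) (fun i _ => hf i) m
  refine le_trans ?_ h2
  rw [Finset.card_univ, le_div_iff₀ (by positivity)]
  calc a ^ (m+1) * Fintype.card ι * (Fintype.card ι : ℝ)^m = (a * Fintype.card ι)^(m+1) := by ring
    _ ≤ _ := pow_le_pow_left₀ (by positivity) h _

theorem aux_fiber {β : Type*} [Fintype β] (t m : ℕ) (σ : Fin t → Fin m)
    (hσ : Function.Injective σ) (F : (Fin t → β) → ℝ) :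
    ∑ X : Fin m → β, F (X ∘ σ) = (Fintype.card β : ℝ) ^ (m - t) * ∑ x, F x := by
  classical
  let e1 : Fin t ⊕ ((Set.range σ)ᶜ : Set (Fin m)) ≃ Fin m :=
    (Equiv.sumCongr (Equiv.ofInjective σ hσ) (Equiv.refl _)).trans (Equiv.Set.sumCompl (Set.range σ))
  let e2 := (Equiv.arrowCongr e1 (Equiv.refl β)).symm.trans (Equiv.sumArrowEquivProdArrow _ _ _)
  have hc : Fintype.card ((Set.range σ)ᶜ : Set (Fin m)) = m - t := by
    have := Fintype.card_congr e1
    simp only [Fintype.card_sum, Fintype.card_fin] at this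
    omega
  have : ∑ X : Fin m → β, F (X ∘ σ) =
      ∑ p : (Fin t → β) × (((Set.range σ)ᶜ : Set (Fin m)) → β), F p.1 := by
    refine Fintype.sum_equiv e2 _ _ fun X => ?_
    congr 1
  rw [this, Fintype.sum_prod_type]
  simp [hc, ← Finset.mul_sum]

open scoped Classical in
theorem aux_sid {β : Type*} [Fintype β] (H : β → β → Prop) (p : ℝ) (hp : 0 ≤ p)
    (h : p * (Fintype.card β : ℝ) ^ 2 ≤ ∑ y, ∑ x, if H x y then (1 : ℝ) else 0) (m : ℕ)
    (hn : 0 < Fintype.card β) :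
    p ^ (m * m) * (Fintype.card β : ℝ) ^ (2 * m) ≤
      ∑ X : Fin m → β, ∑ Y : Fin m → β, if ∀ i j, H (X i) (Y j) then (1 : ℝ) else 0 := by
  have key : ∀ (X : Fin m → β), (∑ Y : Fin m → β, if ∀ i j, H (X i) (Y j) then (1 : ℝ) else 0)
      = (∑ y, if ∀ i, H (X i) y then (1 : ℝ) else 0) ^ m := by
    intro X
    rw [Finset.sum_pow', Fintype.piFinset_univ]
    refine Finset.sum_congr rfl fun Y _ => ?_
    rw [Finset.prod_ite_zero]
    simp only [Finset.prod_const_one, Finset.mem_univ, true_imp_iff]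
    congr 1
    exact propext forall_comm
  have key2 : ∀ y : β, (∑ X : Fin m → β, if ∀ i, H (X i) y then (1 : ℝ) else 0)
      = (∑ x, if H x y then (1 : ℝ) else 0) ^ m := by
    intro y
    rw [Finset.sum_pow', Fintype.piFinset_univ]
    refine Finset.sum_congr rfl fun Y _ => ?_
    rw [Finset.prod_ite_zero]
    simp
  have hnn : ∀ (P : Prop) [Decidable P], (0 : ℝ) ≤ if P then (1 : ℝ) else 0 := fun P _ => by split_ifs <;> norm_num
  simp_rw [key]
  have s1 := aux_jensen (fun y : β => ∑ x, if H x y then (1 : ℝ) else 0)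
    (fun y => Finset.sum_nonneg fun _ _ => hnn _) (p * Fintype.card β) (by positivity)
    (by rw [mul_assoc, ← sq]; exact h) m
  simp_rw [← key2] at s1
  rw [Finset.sum_comm] at s1
  have s2 := aux_jensen (fun X : Fin m → β => ∑ y, if ∀ i, H (X i) y then (1 : ℝ) else 0)
    (fun y => Finset.sum_nonneg fun _ _ => hnn _) (p ^ m * Fintype.card β) (by positivity)
    (by refine le_trans (le_of_eq ?_) s1
        simp only [Fintype.card_fun, Fintype.card_fin]; push_cast; ring) m
  refine le_trans (le_of_eq ?_) s2
  simp only [Fintype.card_fun, Fintype.card_fin]; push_cast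
  rw [mul_pow, ← pow_mul]; ring

open scoped Classical in
/-- common neighbours -/
noncomputable def cnb {β : Type*} [Fintype β] (G : SimpleGraph β) {s : ℕ} (x y : Fin s → β) : Finset β :=
  univ.filter fun z => (∀ i, G.Adj (x i) z) ∧ ∀ j, G.Adj (y j) z

open scoped Classical in
theorem aux_tri_s18 {β : Type} [Fintype β] (G : SimpleGraph β) :
    (homCount triangleGraph G : ℝ) ≤ ∑ y, ∑ x, if G.Adj x y then
      (((univ : Finset β).filter fun z => G.Adj x z ∧ G.Adj y z).card : ℝ) else 0 := by
  have h1 : homCount triangleGraph G ≤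
      Nat.card {q : β × β × β // G.Adj q.2.1 q.1 ∧ G.Adj q.2.1 q.2.2 ∧ G.Adj q.1 q.2.2} := by
    unfold homCount
    refine Nat.card_le_card_of_injective
      (fun f => ⟨(f 1, f 0, f 2), f.map_rel (by simp [triangleGraph]),
        f.map_rel (by simp [triangleGraph]), f.map_rel (by simp [triangleGraph])⟩) ?_
    intro f g h
    simp only [Subtype.mk.injEq, Prod.mk.injEq] at h
    ext i
    fin_cases i
    · exact h.2.1
    · exact h.1
    · exact h.2.2
  refine le_trans (Nat.cast_le.2 h1) (le_of_eq ?_)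
  rw [Nat.card_eq_fintype_card, Fintype.card_subtype, Finset.card_filter]
  push_cast
  rw [Fintype.sum_prod_type]
  refine Finset.sum_congr rfl fun y _ => ?_
  rw [Fintype.sum_prod_type]
  refine Finset.sum_congr rfl fun x _ => ?_
  simp only [Finset.card_filter]
  push_cast
  by_cases h : G.Adj x y <;> simp [h]

open scoped Classical in
theorem aux_ttt {β : Type} [Fintype β] (G : SimpleGraph β) (t : ℕ) :
    (∑ x : Fin t → β, ∑ y : Fin t → β, if ∀ i j, G.Adj (x i) (y j) then
      ((cnb G x y).card : ℝ) ^ t else 0) ≤ (homCount (Kabc t t t) G : ℝ) := by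
  have h1 : Nat.card {q : (Fin t → β) × (Fin t → β) × (Fin t → β) //
      (∀ i j, G.Adj (q.1 i) (q.2.1 j)) ∧ ∀ k, q.2.2 k ∈ cnb G q.1 q.2.1} ≤
      homCount (Kabc t t t) G := by
    unfold homCount
    have : Finite (Kabc t t t →g G) := Finite.of_injective (fun f => (f : _ → β)) DFunLike.coe_injective
    let F : ((Fin t → β) × (Fin t → β) × (Fin t → β)) → (Σ i : Fin 3, Fin (![t, t, t] i)) → β :=
      fun q p => match p with
      | ⟨0, a⟩ => q.1 a
      | ⟨1, a⟩ => q.2.1 a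
      | ⟨2, a⟩ => q.2.2 a
    refine Nat.card_le_card_of_injective (fun q => (⟨F q.1, ?_⟩ : Kabc t t t →g G)) ?_
    · obtain ⟨q, hq, hz⟩ := q
      have hz1 : ∀ i k, G.Adj (q.1 i) (q.2.2 k) := fun i k => by
        have := hz k; simp only [cnb, Finset.mem_filter] at this; exact this.2.1 i
      have hz2 : ∀ i k, G.Adj (q.2.1 i) (q.2.2 k) := fun i k => by
        have := hz k; simp only [cnb, Finset.mem_filter] at this; exact this.2.2 i
      rintro ⟨i, a⟩ ⟨j, b⟩ hij
      have hij : i ≠ j := hij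
      fin_cases i <;> fin_cases j <;> first | exact absurd rfl hij | skip
      · exact hq a b
      · exact hz1 a b
      · exact (hq b a).symm
      · exact hz2 a b
      · exact (hz1 b a).symm
      · exact (hz2 b a).symm
    · intro q r h
      have h' : ∀ p, F q.1 p = F r.1 p := fun p => DFunLike.congr_fun h p
      refine Subtype.ext (Prod.ext ?_ (Prod.ext ?_ ?_))
      · funext a; exact h' ⟨0, a⟩
      · funext a; exact h' ⟨1, a⟩
      · funext a; exact h' ⟨2, a⟩
  refine le_trans (le_of_eq ?_) (Nat.cast_le.2 h1)
  rw [Nat.card_eq_fintype_card, Fintype.card_subtype, Finset.card_filter]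
  push_cast
  rw [Fintype.sum_prod_type]
  refine Finset.sum_congr rfl fun x _ => ?_
  rw [Fintype.sum_prod_type]
  refine Finset.sum_congr rfl fun y _ => ?_
  by_cases h : ∀ i j, G.Adj (x i) (y j)
  · simp only [h, implies_true, true_and, if_true]
    have : (cnb G x y).card ^ t = (Fintype.piFinset fun _ : Fin t => cnb G x y).card := by simp
    rw [← Nat.cast_pow, this, Finset.sum_boole]
    congr 2
    ext z
    simp [Fintype.mem_piFinset]
  · simp [h]

theorem aux_emb (t m : ℕ) : Fintype.card (Fin t ↪o Fin m) ≤ 2 ^ m := by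
  classical
  have : Fintype.card (Fin t ↪o Fin m) ≤ Fintype.card (Finset (Fin m)) := by
    refine Fintype.card_le_of_injective (fun f => univ.map f.toEmbedding) ?_
    intro f g h
    apply OrderEmbedding.range_inj.1
    have := congrArg (fun s : Finset (Fin m) => (s : Set (Fin m))) h
    simpa using this
  simpa using this

open scoped Classical in
theorem aux_good {β : Type} [Fintype β] (G : SimpleGraph β) (γ : ℝ) (hγ : 0 < γ) (t m : ℕ)
    (hm0 : 0 < m) (hm : (t : ℝ) ≤ γ / 4 * m) (X Y : Fin m → β)
    (h : ∀ i j, γ / 2 * Fintype.card β ≤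
      (((univ : Finset β).filter fun z => G.Adj (X i) z ∧ G.Adj (Y j) z).card : ℝ)) :
    γ / 4 * Fintype.card β ≤
      ∑ p : (Fin t ↪o Fin m) × (Fin t ↪o Fin m), ((cnb G (X ∘ p.1) (Y ∘ p.2)).card : ℝ) := by
  set n : ℝ := (Fintype.card β : ℝ) with hn
  let A : β → Finset (Fin m) := fun z => univ.filter fun i => G.Adj (X i) z
  let B : β → Finset (Fin m) := fun z => univ.filter fun i => G.Adj (Y i) z
  have hm' : (0 : ℝ) < m := by exact_mod_cast hm0
  have e1 : (m : ℝ) ^ 2 * (γ / 2 * n) ≤ ∑ z, ((A z).card : ℝ) * (B z).card := by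
    have : ∑ z, ((A z).card : ℝ) * (B z).card = ∑ i, ∑ j,
      (((univ : Finset β).filter fun z => G.Adj (X i) z ∧ G.Adj (Y j) z).card : ℝ) := by
      simp only [A, B, Finset.card_filter]
      push_cast
      simp_rw [Finset.sum_mul_sum]
      rw [Finset.sum_comm]
      refine Finset.sum_congr rfl fun i _ => ?_
      rw [Finset.sum_comm]
      refine Finset.sum_congr rfl fun j _ => ?_
      refine Finset.sum_congr rfl fun z _ => ?_
      by_cases h1 : G.Adj (X i) z <;> by_cases h2 : G.Adj (Y j) z <;> simp [h1, h2]
    rw [this]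
    calc (m : ℝ) ^ 2 * (γ / 2 * n) = ∑ i : Fin m, ∑ j : Fin m, (γ / 2 * n) := by
          simp; ring
      _ ≤ _ := Finset.sum_le_sum fun i _ => Finset.sum_le_sum fun j _ => h i j
  let D : β → ℝ := fun z => ∑ p : (Fin t ↪o Fin m) × (Fin t ↪o Fin m),
    if z ∈ cnb G (X ∘ p.1) (Y ∘ p.2) then (1 : ℝ) else 0
  have e2 : ∀ z, ((A z).card : ℝ) * (B z).card ≤ (m : ℝ) ^ 2 * D z + γ / 4 * (m : ℝ) ^ 2 := by
    intro z
    have hD : 0 ≤ D z := Finset.sum_nonneg fun _ _ => by split_ifs <;> norm_num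
    have hA : ((A z).card : ℝ) ≤ m := by
      exact_mod_cast (Finset.card_le_univ (A z)).trans (by simp)
    have hB : ((B z).card : ℝ) ≤ m := by
      exact_mod_cast (Finset.card_le_univ (B z)).trans (by simp)
    have hA0 : (0 : ℝ) ≤ (A z).card := by positivity
    have hB0 : (0 : ℝ) ≤ (B z).card := by positivity
    by_cases ha : t ≤ (A z).card
    · by_cases hb : t ≤ (B z).card
      · have : 1 ≤ D z := by
          let σ := (A z).orderEmbOfCardLe ha
          let τ := (B z).orderEmbOfCardLe hb
          have hz : z ∈ cnb G (X ∘ σ) (Y ∘ τ) := by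
            simp only [cnb, Finset.mem_filter, Finset.mem_univ, true_and, Function.comp]
            refine ⟨fun i => ?_, fun i => ?_⟩
            · have := (A z).orderEmbOfCardLe_mem ha i
              exact (Finset.mem_filter.1 this).2
            · have := (B z).orderEmbOfCardLe_mem hb i
              exact (Finset.mem_filter.1 this).2
          have := Finset.single_le_sum (f := fun p : (Fin t ↪o Fin m) × (Fin t ↪o Fin m) =>
            if z ∈ cnb G (X ∘ p.1) (Y ∘ p.2) then (1 : ℝ) else 0)
            (fun _ _ => by split_ifs <;> norm_num) (Finset.mem_univ (σ, τ))
          simp only [hz, if_true] at this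
          exact this
        have : (A z).card * (B z).card ≤ (m : ℝ) * m := mul_le_mul hA hB hB0 hm'.le
        have : (m : ℝ)^2 * 1 ≤ (m : ℝ)^2 * D z := by gcongr
        have : 0 ≤ γ / 4 * (m : ℝ) ^ 2 := by positivity
        nlinarith
      · have hb' : ((B z).card : ℝ) ≤ γ / 4 * m := le_trans (by exact_mod_cast (not_le.1 hb).le) hm
        have : (A z).card * (B z).card ≤ (m : ℝ) * (γ / 4 * m) := mul_le_mul hA hb' hB0 hm'.le
        have : 0 ≤ (m : ℝ)^2 * D z := by positivity
        nlinarith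
    · have ha' : ((A z).card : ℝ) ≤ γ / 4 * m := le_trans (by exact_mod_cast (not_le.1 ha).le) hm
      have : (A z).card * (B z).card ≤ (γ / 4 * m) * (m : ℝ) := mul_le_mul ha' hB hB0 (by positivity)
      have : 0 ≤ (m : ℝ)^2 * D z := by positivity
      nlinarith
  have e3 : ∑ z, D z = ∑ p : (Fin t ↪o Fin m) × (Fin t ↪o Fin m),
      ((cnb G (X ∘ p.1) (Y ∘ p.2)).card : ℝ) := by
    simp only [D]
    rw [Finset.sum_comm]
    refine Finset.sum_congr rfl fun p _ => ?_
    simp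
  rw [← e3]
  have e4 := e1.trans (Finset.sum_le_sum fun z _ => e2 z)
  rw [Finset.sum_add_distrib, ← Finset.mul_sum] at e4
  simp only [Finset.sum_const, Finset.card_univ, nsmul_eq_mul, ← hn] at e4
  have : (m : ℝ)^2 * (γ / 4 * n) ≤ (m : ℝ)^2 * ∑ z, D z := by nlinarith
  exact le_of_mul_le_mul_left this (by positivity)

theorem aux_pow {β : Type*} [Fintype β] (f : β → ℝ) (hf : ∀ i, 0 ≤ f i) (q M : ℝ) (hq : 0 < q)
    (hM0 : 0 < M) (hM : (Fintype.card β : ℝ) ≤ M) (h : q ≤ ∑ i, f i) (t : ℕ) :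
    (q / M) ^ t ≤ ∑ i, f i ^ t := by
  have : ∃ i, q / M ≤ f i := by
    by_contra! hc
    rcases isEmpty_or_nonempty β with he | he
    · simp at h; linarith
    have : ∑ i, f i < ∑ i : β, q / M := Finset.sum_lt_sum_of_nonempty univ_nonempty fun i _ => hc i
    simp only [Finset.sum_const, Finset.card_univ, nsmul_eq_mul] at this
    have : (Fintype.card β : ℝ) * (q / M) ≤ M * (q / M) := by gcongr
    have : M * (q / M) = q := by field_simp
    linarith
  obtain ⟨i, hi⟩ := this
  calc (q / M) ^ t ≤ f i ^ t := pow_le_pow_left₀ (by positivity) hi _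
    _ ≤ _ := Finset.single_le_sum (f := fun i => f i ^ t) (fun i _ => pow_nonneg (hf i) _) (mem_univ i)

set_option maxHeartbeats 1000000 in
open scoped Classical in
theorem aux_main_s18 {β : Type} [Fintype β] (G : SimpleGraph β) (γ : ℝ) (hγ : 0 < γ) (t m : ℕ)
    (hm0 : 0 < m) (htm : t ≤ m) (hm : (t : ℝ) ≤ γ / 4 * m) (hd : γ ≤ homDensity triangleGraph G) :
    (γ / 2) ^ (m * m) * (γ / 4 / 4 ^ m) ^ t / 4 ^ m ≤ homDensity (Kabc t t t) G := by
  have hc : Fintype.card (Σ i : Fin 3, Fin (![t, t, t] i)) = 3 * t := by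
    simp [Fintype.card_sigma, Fin.sum_univ_three]; ring
  have hn : 0 < Fintype.card β := by
    by_contra h0
    have : Fintype.card β = 0 := by omega
    simp [homDensity, this] at hd
    linarith
  unfold homDensity at hd ⊢
  rw [hc]
  set n : ℝ := (Fintype.card β : ℝ) with hndef
  have hn' : 0 < n := by rw [hndef]; exact_mod_cast hn
  rw [le_div_iff₀ (by positivity)] at hd ⊢
  simp only [Fintype.card_fin] at hd
  let cd : β → β → ℝ := fun x y => (((univ : Finset β).filter fun z => G.Adj x z ∧ G.Adj y z).card : ℝ)
  obtain ⟨H, hHd⟩ : ∃ H : β → β → Prop, ∀ x y, H x y ↔ (G.Adj x y ∧ γ / 2 * n ≤ cd x y) :=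
    ⟨_, fun x y => Iff.rfl⟩
  have hH : γ / 2 * n ^ 2 ≤ ∑ y, ∑ x, if H x y then (1 : ℝ) else 0 := by
    have h1 := hd.trans (aux_tri_s18 G)
    have h2 : (∑ y, ∑ x, if G.Adj x y then cd x y else 0) ≤
        ∑ y : β, ∑ x : β, (n * (if H x y then (1 : ℝ) else 0) + γ / 2 * n) := by
      refine Finset.sum_le_sum fun y _ => Finset.sum_le_sum fun x _ => ?_
      have hcd : cd x y ≤ n := by
        simp only [cd, hndef]; exact_mod_cast Finset.card_le_univ _
      have : 0 < γ / 2 * n := by positivity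
      by_cases ha : G.Adj x y
      · by_cases hb : γ / 2 * n ≤ cd x y
        · simp only [hHd, ha, hb, and_self, if_true]; linarith
        · simp only [hHd, ha, hb, and_false, if_true, if_false]; push Not at hb; linarith
      · simp only [hHd, ha, false_and, if_false]; linarith
    have h3 := h1.trans h2
    simp only [Finset.sum_add_distrib, ← Finset.mul_sum, Finset.sum_const, Finset.card_univ,
      nsmul_eq_mul, ← hndef] at h3
    have : n * (γ / 2 * n ^ 2) ≤ n * ∑ y, ∑ x, if H x y then (1 : ℝ) else 0 := by nlinarith
    exact le_of_mul_le_mul_left this hn'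
  have hS := aux_sid H (γ / 2) (by positivity) hH m hn
  rw [← hndef] at hS
  set T : ℝ := ∑ x : Fin t → β, ∑ y : Fin t → β, if ∀ i j, G.Adj (x i) (y j) then
      ((cnb G x y).card : ℝ) ^ t else 0 with hT
  have hTle : T ≤ _ := aux_ttt G t
  refine le_trans ?_ hTle
  have hT0 : 0 ≤ T := Finset.sum_nonneg fun _ _ => Finset.sum_nonneg fun _ _ => by
    split_ifs <;> positivity
  clear_value T n
  have hM : (Fintype.card ((Fin t ↪o Fin m) × (Fin t ↪o Fin m)) : ℝ) ≤ 4 ^ m := by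
    rw [Fintype.card_prod]
    have := Nat.mul_le_mul (aux_emb t m) (aux_emb t m)
    rw [← mul_pow] at this
    exact_mod_cast this
  have hpt : ∀ X Y : Fin m → β, (γ / 4 * n / 4 ^ m) ^ t * (if ∀ i j, H (X i) (Y j) then (1 : ℝ) else 0)
      ≤ ∑ p : (Fin t ↪o Fin m) × (Fin t ↪o Fin m),
        if ∀ i j, G.Adj ((X ∘ p.1) i) ((Y ∘ p.2) j) then
          ((cnb G (X ∘ p.1) (Y ∘ p.2)).card : ℝ) ^ t else 0 := by
    intro X Y
    by_cases hXY : ∀ i j, H (X i) (Y j)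
    · have g1 := aux_good G γ hγ t m hm0 hm X Y (fun i j => hndef ▸ ((hHd _ _).1 (hXY i j)).2)
      rw [← hndef] at g1
      have g2 := aux_pow _ (fun p => Nat.cast_nonneg _) (γ / 4 * n) (4 ^ m) (by positivity)
        (by positivity) hM g1 t
      rw [if_pos hXY, mul_one]
      refine g2.trans (le_of_eq (Finset.sum_congr rfl fun p _ => ?_))
      have hadj : ∀ i j, G.Adj ((X ∘ p.1) i) ((Y ∘ p.2) j) := fun i j => ((hHd _ _).1 (hXY _ _)).1
      rw [if_pos hadj]
    · rw [if_neg hXY, mul_zero]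
      exact Finset.sum_nonneg fun _ _ => by split_ifs <;> positivity
  have hsum : (γ / 4 * n / 4 ^ m) ^ t * ((γ / 2) ^ (m * m) * n ^ (2 * m)) ≤
      4 ^ m * (n ^ (m - t) * (n ^ (m - t) * T)) := by
    calc _ ≤ (γ / 4 * n / 4 ^ m) ^ t * ∑ X : Fin m → β, ∑ Y : Fin m → β, 
            (if ∀ i j, H (X i) (Y j) then (1 : ℝ) else 0) :=
            mul_le_mul_of_nonneg_left hS (by positivity)
      _ ≤ ∑ X : Fin m → β, ∑ Y : Fin m → β, ∑ p : (Fin t ↪o Fin m) × (Fin t ↪o Fin m),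
        if ∀ i j, G.Adj ((X ∘ p.1) i) ((Y ∘ p.2) j) then
          ((cnb G (X ∘ p.1) (Y ∘ p.2)).card : ℝ) ^ t else 0 := by
          simp_rw [Finset.mul_sum]
          exact Finset.sum_le_sum fun X _ => Finset.sum_le_sum fun Y _ => hpt X Y
      _ = ∑ p : (Fin t ↪o Fin m) × (Fin t ↪o Fin m), (n ^ (m - t) * (n ^ (m - t) * T)) := by
          rw [Finset.sum_congr rfl fun X _ => Finset.sum_comm, Finset.sum_comm]
          refine Finset.sum_congr rfl fun p _ => ?_
          rw [hT, hndef]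
          have f1 : ∀ x : Fin t → β, (∑ Y : Fin m → β, if ∀ i j, G.Adj (x i) ((Y ∘ p.2) j) then
            ((cnb G x (Y ∘ p.2)).card : ℝ) ^ t else 0) = _ := fun x =>
            aux_fiber t m p.2 p.2.injective (fun y => if ∀ i j, G.Adj (x i) (y j) then
              ((cnb G x y).card : ℝ) ^ t else 0)
          rw [Finset.sum_congr rfl fun X _ => f1 (X ∘ p.1)]
          rw [aux_fiber t m p.1 p.1.injective (fun x => (Fintype.card β : ℝ) ^ (m - t) *
            ∑ y, if ∀ i j, G.Adj (x i) (y j) then ((cnb G x y).card : ℝ) ^ t else 0)]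
          rw [← Finset.mul_sum]
      _ ≤ _ := by
          rw [Finset.sum_const, Finset.card_univ, nsmul_eq_mul]
          exact mul_le_mul_of_nonneg_right hM
            (mul_nonneg (pow_nonneg hn'.le _) (mul_nonneg (pow_nonneg hn'.le _) hT0))
  obtain ⟨k, rfl⟩ := Nat.exists_eq_add_of_le htm
  rw [Nat.add_sub_cancel_left] at hsum
  set M : ℝ := 4 ^ (t + k) with hMdef
  have hMpos : 0 < M := by positivity
  rw [div_mul_eq_mul_div, div_le_iff₀ hMpos]
  have hk : 0 < n ^ (2 * k) := by positivity
  refine le_of_mul_le_mul_right ?_ hk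
  calc _ = (γ / 4 * n / M) ^ t * ((γ / 2) ^ ((t+k) * (t+k)) * n ^ (2 * (t+k))) := by
        rw [show γ / 4 * n / M = (γ / 4 / M) * n by ring, mul_pow]; ring
    _ ≤ _ := hsum
    _ = _ := by ring

theorem aux_log (x : ℝ) : x ≤ (2 : ℝ) ^ x := by
  rcases le_or_gt x 0 with h | h
  · exact h.trans (by positivity)
  have h1 := Nat.lt_floor_add_one x
  have h2 : ⌊x⌋₊ + 1 ≤ 2 ^ ⌊x⌋₊ := Nat.lt_two_pow_self
  have h3 : (2 : ℝ) ^ (⌊x⌋₊ : ℝ) ≤ 2 ^ x :=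
    Real.rpow_le_rpow_of_exponent_le (by norm_num) (Nat.floor_le h.le)
  rw [Real.rpow_natCast] at h3
  have : ((⌊x⌋₊ : ℝ) + 1) ≤ 2 ^ ⌊x⌋₊ := by exact_mod_cast h2
  linarith


/-- There is an absolute constant `c > 0` such that for every `0 < γ < 1` and
every `t ≥ 1` there is `N` so that every graph on `n ≥ N` vertices with triangle
density at least `γ` has `K_{t,t,t}`-density at least `2^(−c·t²/γ³)`. -/
theorem nikiforov_consequence :
    ∃ c : ℝ, 0 < c ∧ ∀ γ : ℝ, 0 < γ → γ < 1 → ∀ t : ℕ, 0 < t →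
      ∃ N : ℕ, ∀ (β : Type) [Fintype β] (G : SimpleGraph β),
        N ≤ Fintype.card β →
        γ ≤ homDensity triangleGraph G →
        (2 : ℝ) ^ (-(c * (t : ℝ) ^ 2 / γ ^ 3)) ≤ homDensity (Kabc t t t) G := by
  refine ⟨100, by norm_num, fun γ hγ hγ1 t ht => ⟨0, fun β _ G _ hd => ?_⟩⟩
  have ht1 : (1 : ℝ) ≤ t := by exact_mod_cast ht
  set g : ℝ := 1 / γ with hg
  have hg1 : 1 ≤ g := by rw [hg, le_div_iff₀ hγ]; linarith
  have hgγ : g * γ = 1 := by rw [hg]; field_simp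
  set m : ℕ := ⌈4 * t * g⌉₊ with hm
  have hm1 : 4 * t * g ≤ m := Nat.le_ceil _
  have htg : 1 ≤ t * g := by nlinarith
  have hm2 : (m : ℝ) ≤ 5 * t * g := by
    have := (Nat.ceil_lt_add_one (show 0 ≤ 4 * t * g by positivity)).le
    linarith
  have htm' : (t : ℝ) ≤ m := by nlinarith
  have htm : t ≤ m := by exact_mod_cast htm'
  have h1 := aux_main_s18 G γ hγ t m (by omega) htm
    (by have : γ / 4 * (4 * t * g) ≤ γ / 4 * m := by gcongr
        have e : γ / 4 * (4 * t * g) = t := by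
          calc _ = t * (g * γ) := by ring
            _ = t := by rw [hgγ, mul_one]
        linarith) hd
  refine le_trans ?_ h1
  have two : (0 : ℝ) < 2 := by norm_num
  have a1 : (2 : ℝ) ^ (-(2 * g)) ≤ γ / 2 := by
    rw [Real.rpow_neg two.le]
    have := aux_log (2 * g)
    calc _ ≤ (2 * g)⁻¹ := by gcongr
      _ = γ / 2 := by rw [hg]; field_simp
  have a2 : (2 : ℝ) ^ (-(4 * g)) ≤ γ / 4 := by
    rw [Real.rpow_neg two.le]
    have := aux_log (4 * g)
    calc _ ≤ (4 * g)⁻¹ := by gcongr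
      _ = γ / 4 := by rw [hg]; field_simp
  have a3 : (4 : ℝ) ^ m = 2 ^ (2 * (m : ℝ)) := by
    rw [Real.rpow_mul two.le, Real.rpow_natCast]; norm_num
  have step : ((2 : ℝ) ^ (-(2 * g))) ^ (m * m) * ((2 : ℝ) ^ (-(4 * g)) / 4 ^ m) ^ t / 4 ^ m ≤
      (γ / 2) ^ (m * m) * (γ / 4 / 4 ^ m) ^ t / 4 ^ m := by gcongr
  refine le_trans ?_ step
  rw [a3, ← Real.rpow_sub two, ← Real.rpow_natCast _ (m * m), ← Real.rpow_natCast _ t, ← Real.rpow_mul two.le,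
    ← Real.rpow_mul two.le, ← Real.rpow_add two, ← Real.rpow_sub two]
  apply Real.rpow_le_rpow_of_exponent_le (by norm_num)
  have e : 100 * (t : ℝ) ^ 2 / γ ^ 3 = 100 * (t : ℝ) ^ 2 * g ^ 3 := by rw [hg]; field_simp
  rw [e]
  push_cast
  have hmm : (m : ℝ) * m ≤ (5 * t * g) * (5 * t * g) := by gcongr
  have b1 : 2 * g * ((m : ℝ) * m) ≤ 50 * (t^2 * g^3) := by
    calc _ ≤ 2 * g * ((5 * t * g) * (5 * t * g)) := by gcongr
      _ = _ := by ring
  have c1 : (t : ℝ) ≤ t^2 := by nlinarith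
  have c2 : g ≤ g^3 := by nlinarith [sq_nonneg g]
  have b2 : t * g ≤ (t : ℝ)^2 * g^3 := by gcongr
  have b3 : (t : ℝ)^2 * g ≤ (t : ℝ)^2 * g^3 := by gcongr
  have b4 : 2 * (m : ℝ) * t ≤ 10 * (t^2 * g) := by
    calc _ ≤ 2 * (5 * t * g) * t := by gcongr
      _ = _ := by ring
  nlinarith
end
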